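/- arXiv:math/0403138 — 2 statements merged into one kernel-verified Lean document; each statement's English description precedes it below -/
import Mathlib

section
/- Let M be the C[[x,y]]-module with generators β₀, β₁, …, β_n, γ subject to the relations x·β_i − y·β_{i−1} = 0 for 1 ≤ i ≤ n. Then the natural map ρ: M → M^∨∨ into the double dual has cokernel isomorphic as a C-vector space to the quotient of the free module on one generator B by the submodule generated by x^i y^{n−i} B for 0 ≤ i ≤ n; in particular M^∨ is free of rank two and coker(ρ) is finite dimensional. -/
/-!
STATEMENT 10. Let `M` be the `ℂ[[x,y]]`-module with generators `β₀, β₁, …, β_n, γ` subject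
to the relations `x·β_i − y·β_{i−1} = 0` for `1 ≤ i ≤ n`. Then the natural evaluation map
`ρ : M → M^∨∨` into the double dual has cokernel isomorphic, as a `ℂ`-vector space, to the
quotient of the free module on one generator `B` by the submodule generated by
`x^i y^{n−i} B` for `0 ≤ i ≤ n`; in particular `M^∨` is free of rank two and `coker ρ` is
finite dimensional over `ℂ`.
-/

set_option synthInstance.maxHeartbeats 1000000

noncomputable section

/-- The formal power series ring `ℂ[[x,y]]`. -/
abbrev PS : Type := MvPowerSeries (Fin 2) ℂ

/-- The variable `x` of `ℂ[[x,y]]`. -/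
def xx : PS := MvPowerSeries.X 0

/-- The variable `y` of `ℂ[[x,y]]`. -/
def yy : PS := MvPowerSeries.X 1

/-- The free `ℂ[[x,y]]`-module on the `n + 2` generators `β₀, …, β_n, γ`. -/
abbrev FreeMod (n : ℕ) : Type := (Fin (n + 1) ⊕ Unit) → PS

/-- The generator `β_i`. -/
def beta (n : ℕ) (i : Fin (n + 1)) : FreeMod n := Pi.single (Sum.inl i) 1

/-- The generator `γ`. -/
def gam (n : ℕ) : FreeMod n := Pi.single (Sum.inr ()) 1

/-- The submodule of relations `x·β_i − y·β_{i−1}` for `1 ≤ i ≤ n`. -/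
def relations (n : ℕ) : Submodule PS (FreeMod n) :=
  Submodule.span PS
    {r | ∃ i : Fin (n + 1), ∃ h : 1 ≤ (i : ℕ),
      r = xx • beta n i - yy • beta n ⟨(i : ℕ) - 1, by omega⟩}

/-- The module `M = ⟨β₀, …, β_n, γ⟩ / (x·β_i − y·β_{i−1}, 1 ≤ i ≤ n)`. -/
abbrev Mmod (n : ℕ) : Type := FreeMod n ⧸ relations n

/-- The canonical evaluation map `ρ : M → M^∨∨`. -/
def rho (n : ℕ) : Mmod n →ₗ[PS] Module.Dual PS (Module.Dual PS (Mmod n)) :=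
  Module.Dual.eval PS (Mmod n)

/-- The cokernel of `ρ : M → M^∨∨`. -/
abbrev cokerRho (n : ℕ) : Type :=
  Module.Dual PS (Module.Dual PS (Mmod n)) ⧸ LinearMap.range (rho n)

/-- The ideal `(x^i y^{n−i} : 0 ≤ i ≤ n)`, i.e. the submodule of the free module on one
generator `B` generated by the elements `x^i y^{n−i} B`. -/
def relIdeal (n : ℕ) : Ideal PS :=
  Ideal.span (Set.range fun i : Fin (n + 1) => xx ^ (i : ℕ) * yy ^ (n - (i : ℕ)))

instance instIsDomainPS : IsDomain PS := NoZeroDivisors.to_isDomain PS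

theorem xx_ne_zero : xx ≠ 0 := by
  intro h
  have h1 := congrArg (MvPowerSeries.coeff (Finsupp.single (0 : Fin 2) 1)) h
  simp [xx] at h1

theorem xx_pow_dvd_of_dvd_yy_pow_mul {n : ℕ} {f : PS} (h : xx ^ n ∣ yy ^ n * f) :
    xx ^ n ∣ f := by
  refine MvPowerSeries.X_pow_dvd_iff.2 fun m hm => ?_
  have h1 := MvPowerSeries.X_pow_dvd_iff.1 h (Finsupp.single 1 n + m) (by simpa using hm)
  rwa [yy, MvPowerSeries.X_pow_eq, MvPowerSeries.coeff_add_monomial_mul, one_mul] at h1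

/-- The class of `β_i` in `M`. -/
def betaM (n : ℕ) (i : Fin (n + 1)) : Mmod n := (relations n).mkQ (beta n i)

/-- The class of `γ` in `M`. -/
def gamM (n : ℕ) : Mmod n := (relations n).mkQ (gam n)

theorem dual_ext {n : ℕ} {f g : Module.Dual PS (Mmod n)}
    (hb : ∀ i, f (betaM n i) = g (betaM n i)) (hc : f (gamM n) = g (gamM n)) : f = g := by
  apply Submodule.linearMap_qext
  apply LinearMap.pi_ext'
  rintro (i | u)
  · exact LinearMap.ext_ring (hb i)
  · exact LinearMap.ext_ring hc

theorem xx_smul_betaM (n i : ℕ) (hi : i + 1 < n + 1) :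
    xx • betaM n ⟨i + 1, hi⟩ = yy • betaM n ⟨i, by omega⟩ := by
  rw [← sub_eq_zero, betaM, betaM, ← map_smul, ← map_smul, ← map_sub, Submodule.mkQ_apply,
    Submodule.Quotient.mk_eq_zero]
  exact Submodule.subset_span ⟨⟨i + 1, hi⟩, by simp, rfl⟩

theorem xx_pow_mul_dual_betaM {n : ℕ} (f : Module.Dual PS (Mmod n)) (i : ℕ) (hi : i < n + 1) :
    xx ^ i * f (betaM n ⟨i, hi⟩) = yy ^ i * f (betaM n 0) := by
  induction i with
  | zero => simp
  | succ i ih =>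
    have h := congrArg f (xx_smul_betaM n i hi)
    simp only [map_smul, smul_eq_mul] at h
    calc xx ^ (i + 1) * f (betaM n ⟨i + 1, hi⟩)
        = xx ^ i * (xx * f (betaM n ⟨i + 1, hi⟩)) := by ring
      _ = yy * (xx ^ i * f (betaM n ⟨i, by omega⟩)) := by rw [h]; ring
      _ = yy ^ (i + 1) * f (betaM n 0) := by rw [ih]; ring

/-- The functional on the free module with `β_i ↦ g x^{n-i} y^i` and `γ ↦ h`. -/
def freeDualMk (n : ℕ) (g h : PS) : Module.Dual PS (FreeMod n) :=
  LinearMap.lsum PS (fun _ => PS) PS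
    (Sum.elim (fun i : Fin (n + 1) =>
      LinearMap.toSpanSingleton PS PS (g * (xx ^ (n - (i : ℕ)) * yy ^ (i : ℕ))))
      (fun _ => LinearMap.toSpanSingleton PS PS h))

theorem freeDualMk_beta (n : ℕ) (g h : PS) (i : Fin (n + 1)) :
    freeDualMk n g h (beta n i) = g * (xx ^ (n - (i : ℕ)) * yy ^ (i : ℕ)) := by
  simp [freeDualMk, beta, Pi.single_apply]

theorem freeDualMk_gam (n : ℕ) (g h : PS) : freeDualMk n g h (gam n) = h := by
  simp [freeDualMk, gam]

/-- The functional on `M` with `β_i ↦ g x^{n-i} y^i` and `γ ↦ h`. -/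
def dualMk (n : ℕ) (g h : PS) : Module.Dual PS (Mmod n) :=
  (relations n).liftQ (freeDualMk n g h) (by
    rw [relations, Submodule.span_le]
    rintro _ ⟨⟨i, hi⟩, h1, rfl⟩
    obtain ⟨j, rfl⟩ : ∃ j, i = j + 1 := ⟨i - 1, by simp at h1; omega⟩
    obtain ⟨k, rfl⟩ : ∃ k, n = j + 1 + k := ⟨n - (j + 1), by omega⟩
    have e : j + 1 + k - j = k + 1 := by omega
    rw [SetLike.mem_coe, LinearMap.mem_ker, map_sub, map_smul, map_smul, freeDualMk_beta,
      freeDualMk_beta]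
    simp only [add_tsub_cancel_left, add_tsub_cancel_right, e, smul_eq_mul]
    ring)

@[simp] theorem dualMk_betaM (n : ℕ) (g h : PS) (i : Fin (n + 1)) :
    dualMk n g h (betaM n i) = g * (xx ^ (n - (i : ℕ)) * yy ^ (i : ℕ)) :=
  freeDualMk_beta n g h i

@[simp] theorem dualMk_gamM (n : ℕ) (g h : PS) : dualMk n g h (gamM n) = h :=
  freeDualMk_gam n g h

/-- `M^∨` is free on `B` and `C`. -/
def dualEquiv (n : ℕ) : (PS × PS) ≃ₗ[PS] Module.Dual PS (Mmod n) :=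
  LinearEquiv.ofBijective
    { toFun := fun p => dualMk n p.1 p.2
      map_add' := fun p q => dual_ext (fun i => by simp; ring) (by simp)
      map_smul' := fun a p => dual_ext (fun i => by simp; ring) (by simp) }
    (by
      constructor
      · intro p q hpq
        have h0 := LinearMap.congr_fun hpq (betaM n 0)
        have h1 := LinearMap.congr_fun hpq (gamM n)
        simp only [LinearMap.coe_mk, AddHom.coe_mk, dualMk_betaM, dualMk_gamM] at h0 h1
        refine Prod.ext (mul_right_cancel₀ ?_ h0) h1
        simpa using pow_ne_zero n xx_ne_zero
      · intro f
        have hd : xx ^ n ∣ f (betaM n 0) := xx_pow_dvd_of_dvd_yy_pow_mul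
          ⟨_, (xx_pow_mul_dual_betaM f n (Nat.lt_succ_self n)).symm⟩
        obtain ⟨g, hg⟩ := hd
        refine ⟨(g, f (gamM n)), dual_ext (fun i => ?_) (by simp)⟩
        obtain ⟨i, hi⟩ := i
        apply mul_left_cancel₀ (pow_ne_zero i xx_ne_zero)
        rw [xx_pow_mul_dual_betaM f, hg]
        have e : xx ^ n = xx ^ i * xx ^ (n - i) := by rw [← pow_add]; congr 1; omega
        simp only [LinearMap.coe_mk, AddHom.coe_mk, dualMk_betaM, e]
        ring)

theorem relIdeal_eq_span (n : ℕ) : relIdeal n =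
    Ideal.span (Set.range fun i : Fin (n + 1) => xx ^ (n - (i : ℕ)) * yy ^ (i : ℕ)) := by
  rw [relIdeal, ← Fin.rev_surjective.range_comp]
  congr 2
  ext1 i
  have h : n - (n - (i : ℕ)) = i := by omega
  simp [Fin.val_rev, h]

/-- The map `M^∨∨ → ℂ[[x,y]] ⧸ (x^i y^{n-i})`, `φ ↦ φ(B)`. -/
def evalB (n : ℕ) : Module.Dual PS (Module.Dual PS (Mmod n)) →ₗ[PS] PS ⧸ relIdeal n :=
  (relIdeal n).mkQ ∘ₗ Module.Dual.eval PS _ (dualMk n 1 0)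

theorem evalB_surjective (n : ℕ) : Function.Surjective (evalB n) := by
  intro q
  obtain ⟨g, rfl⟩ := (relIdeal n).mkQ_surjective q
  refine ⟨g • (LinearMap.fst PS PS PS ∘ₗ (dualEquiv n).symm.toLinearMap), ?_⟩
  have h : (dualEquiv n).symm (dualMk n 1 0) = (1, 0) := by
    rw [LinearEquiv.symm_apply_eq]; rfl
  simp only [evalB, LinearMap.comp_apply, Module.Dual.eval_apply, LinearMap.smul_apply,
    LinearEquiv.coe_coe, h, LinearMap.fst_apply, smul_eq_mul, mul_one]

theorem dual_dual_ext {n : ℕ} {φ ψ : Module.Dual PS (Module.Dual PS (Mmod n))}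
    (hB : φ (dualMk n 1 0) = ψ (dualMk n 1 0)) (hC : φ (dualMk n 0 1) = ψ (dualMk n 0 1)) :
    φ = ψ := by
  have key : φ ∘ₗ (dualEquiv n).toLinearMap = ψ ∘ₗ (dualEquiv n).toLinearMap := by
    apply LinearMap.prod_ext <;> apply LinearMap.ext_ring <;> simpa
  ext1 f
  obtain ⟨p, rfl⟩ := (dualEquiv n).surjective f
  exact LinearMap.congr_fun key p

theorem dualMk_one_zero_mem (n : ℕ) (m : Mmod n) : dualMk n 1 0 m ∈ relIdeal n := by
  have h : (relIdeal n).mkQ ∘ₗ dualMk n 1 0 = 0 := by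
    apply Submodule.linearMap_qext
    apply LinearMap.pi_ext'
    rintro (i | u)
    · apply LinearMap.ext_ring
      change (relIdeal n).mkQ (dualMk n 1 0 (betaM n i)) = 0
      rw [dualMk_betaM, one_mul, Submodule.mkQ_apply, Submodule.Quotient.mk_eq_zero,
        relIdeal_eq_span]
      exact Ideal.subset_span ⟨i, rfl⟩
    · apply LinearMap.ext_ring
      change (relIdeal n).mkQ (dualMk n 1 0 (gamM n)) = 0
      simp
  exact (Submodule.Quotient.mk_eq_zero _).1 (LinearMap.congr_fun h m)

theorem ker_evalB (n : ℕ) : LinearMap.ker (evalB n) = LinearMap.range (rho n) := by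
  ext φ
  have hk : φ ∈ LinearMap.ker (evalB n) ↔ φ (dualMk n 1 0) ∈ relIdeal n := by
    rw [LinearMap.mem_ker, evalB, LinearMap.comp_apply, Submodule.mkQ_apply,
      Submodule.Quotient.mk_eq_zero, Module.Dual.eval_apply]
  rw [hk]
  constructor
  · intro h
    rw [relIdeal_eq_span, Ideal.mem_span_range_iff_exists_fun] at h
    obtain ⟨c, hc⟩ := h
    refine ⟨∑ i, c i • betaM n i + φ (dualMk n 0 1) • gamM n, dual_dual_ext ?_ ?_⟩
    · simp [rho, hc]
    · simp [rho]
  · rintro ⟨m, rfl⟩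
    exact dualMk_one_zero_mem n m

/-- The polynomial with prescribed coefficients at the monomials `x^a y^b`, `a, b < n`. -/
def ofCoeffs (n : ℕ) : (Fin n × Fin n → ℂ) →ₗ[ℂ] PS :=
  LinearMap.pi fun m : Fin 2 →₀ ℕ =>
    if h : m 0 < n ∧ m 1 < n then LinearMap.proj (⟨m 0, h.1⟩, ⟨m 1, h.2⟩) else 0

theorem coeff_ofCoeffs {n : ℕ} (c : Fin n × Fin n → ℂ) {m : Fin 2 →₀ ℕ} (h0 : m 0 < n)
    (h1 : m 1 < n) : MvPowerSeries.coeff m (ofCoeffs n c) = c (⟨m 0, h0⟩, ⟨m 1, h1⟩) :=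
  LinearMap.congr_fun (dif_pos ⟨h0, h1⟩) c

theorem xx_pow_mem_relIdeal (n : ℕ) : xx ^ n ∈ relIdeal n :=
  Ideal.subset_span ⟨Fin.last n, by simp⟩

theorem yy_pow_mem_relIdeal (n : ℕ) : yy ^ n ∈ relIdeal n :=
  Ideal.subset_span ⟨0, by simp⟩

theorem mem_relIdeal_of_coeff_eq_zero {n : ℕ} {f : PS}
    (hf : ∀ m : Fin 2 →₀ ℕ, m 0 < n → m 1 < n → MvPowerSeries.coeff m f = 0) :
    f ∈ relIdeal n := by
  let f₁ : PS := fun m => if m 0 < n then MvPowerSeries.coeff m f else 0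
  have h₁ (m : Fin 2 →₀ ℕ) :
      MvPowerSeries.coeff m f₁ = if m 0 < n then MvPowerSeries.coeff m f else 0 := rfl
  have hy : yy ^ n ∣ f₁ := by
    refine MvPowerSeries.X_pow_dvd_iff.2 fun m hm => ?_
    rw [h₁]
    split_ifs with h
    · exact hf m h hm
    · rfl
  have hx : xx ^ n ∣ f - f₁ := by
    refine MvPowerSeries.X_pow_dvd_iff.2 fun m hm => ?_
    rw [map_sub, h₁, if_pos hm, sub_self]
  rw [← sub_add_cancel f f₁]
  exact add_mem (Ideal.mem_of_dvd _ hx (xx_pow_mem_relIdeal n))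
    (Ideal.mem_of_dvd _ hy (yy_pow_mem_relIdeal n))

theorem finite_quotient_relIdeal (n : ℕ) : Module.Finite ℂ (PS ⧸ relIdeal n) := by
  refine Module.Finite.of_surjective
    (((relIdeal n).mkQ.restrictScalars ℂ) ∘ₗ ofCoeffs n) fun q => ?_
  obtain ⟨f, rfl⟩ := (relIdeal n).mkQ_surjective q
  refine ⟨fun p => MvPowerSeries.coeff
    (Finsupp.single 0 (p.1 : ℕ) + Finsupp.single 1 (p.2 : ℕ)) f, ?_⟩
  refine (Submodule.Quotient.eq _).2 (mem_relIdeal_of_coeff_eq_zero fun m h0 h1 => ?_)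
  have hm : Finsupp.single 0 (m 0) + Finsupp.single 1 (m 1) = m := by
    ext i
    fin_cases i <;> simp
  rw [map_sub, sub_eq_zero]
  refine (coeff_ofCoeffs _ h0 h1).trans ?_
  simp only [hm]

/-- The cokernel of the evaluation map `ρ : M → M^∨∨` is isomorphic as a `ℂ`-vector space
to `ℂ[[x,y]]·B ⧸ (x^i y^{n−i} B : 0 ≤ i ≤ n)`; in particular `M^∨` is free of rank two and
`coker ρ` is finite dimensional over `ℂ`. -/
theorem coker_eval_isomorphism (n : ℕ) :
    Nonempty (cokerRho n ≃ₗ[ℂ] (PS ⧸ relIdeal n)) ∧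
      (Module.Free PS (Module.Dual PS (Mmod n)) ∧
        Module.finrank PS (Module.Dual PS (Mmod n)) = 2) ∧
      FiniteDimensional ℂ (cokerRho n) := by
  let e : cokerRho n ≃ₗ[PS] (PS ⧸ relIdeal n) :=
    (Submodule.quotEquivOfEq _ _ (ker_evalB n).symm).trans
      ((evalB n).quotKerEquivOfSurjective (evalB_surjective n))
  have hfin := finite_quotient_relIdeal n
  refine ⟨⟨e.restrictScalars ℂ⟩, ⟨Module.Free.of_equiv (dualEquiv n), ?_⟩,
    Module.Finite.equiv (e.restrictScalars ℂ).symm⟩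
  rw [← (dualEquiv n).finrank_eq]
  simp

end
end

section
/- Let j ≥ 1, let p ∈ C[z, z⁻¹, u] be a Laurent polynomial all of whose z-exponents are strictly less than j, and let b ∈ C[z, u] be a polynomial (only nonnegative powers of z). If 2i·p = (z^j − z^{−j})·b holds in C[z, z⁻¹, u] (i the imaginary unit), then b = 0 and p = 0. Consequently, a framed rank two bundle on the blow-up of C² with c₁ = 0, splitting type j and extension class p ≠ 0 admits no traceless automorphisms. -/
/-!
STATEMENT 17 (Lemma 6.7). Let `j ≥ 1`, let `p ∈ ℂ[z, z⁻¹, u]` be a Laurent polynomial all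
of whose `z`-exponents are strictly less than `j`, and let `b ∈ ℂ[z, u]` (only nonnegative
powers of `z`). If `2i·p = (z^j − z^{−j})·b` in `ℂ[z, z⁻¹, u]` (`i` the imaginary unit),
then `b = 0` and `p = 0`. Consequently, a framed rank two bundle on the blow-up of `ℂ²`
with `c₁ = 0`, splitting type `j` and extension class `p ≠ 0` admits no traceless
automorphisms: no traceless matrix `±(i, b; 0, −i)` commutes with the transition matrix
`T = (z^j, p; 0, z^{−j})`.
-/

/-- The ring `ℂ[z, z⁻¹, u]`; `z` is the Laurent variable `LaurentPolynomial.T 1` and `u`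
the coefficient variable `Polynomial.X`. -/
abbrev CoordRing : Type := LaurentPolynomial (Polynomial ℂ)

/-- `HasZExponentsLT p j` : all `z`-exponents of `p ∈ ℂ[z, z⁻¹, u]` are strictly less than
`j`; equivalently `p = z^{−N}·q` for a polynomial `q ∈ ℂ[z, u]` of `z`-degree `< N + j`. -/
def HasZExponentsLT (p : CoordRing) (j : ℕ) : Prop :=
  ∃ (q : Polynomial (Polynomial ℂ)) (N : ℕ),
    p = LaurentPolynomial.T (-(N : ℤ)) * q.toLaurent ∧ q.degree < ((N + j : ℕ) : WithBot ℕ)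

/-- The constant `i` (imaginary unit) as an element of `ℂ[z, z⁻¹, u]`. -/
noncomputable def iConst : CoordRing := LaurentPolynomial.C (Polynomial.C Complex.I)

/-- The transition matrix `T = (z^j, p; 0, z^{−j})` over `ℂ[z, z⁻¹, u]`. -/
noncomputable def transitionMatrix (j : ℕ) (p : CoordRing) : Matrix (Fin 2) (Fin 2) CoordRing :=
  !![LaurentPolynomial.T (j : ℤ), p; 0, LaurentPolynomial.T (-(j : ℤ))]

open LaurentPolynomial in
theorem eq_zero_of_C_mul_eq {j : ℕ} (hj : 1 ≤ j) {p : CoordRing} (hp : HasZExponentsLT p j)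
    (b : Polynomial (Polynomial ℂ))
    (h : C (Polynomial.C (2 * Complex.I)) * p = (T (j : ℤ) - T (-(j : ℤ))) * b.toLaurent) :
    b = 0 ∧ p = 0 := by
  obtain ⟨q, N, rfl, hq⟩ := hp
  have hc : (Polynomial.C (2 * Complex.I) : Polynomial ℂ) ≠ 0 := by simp
  generalize (Polynomial.C (2 * Complex.I) : Polynomial ℂ) = c at h hc
  have key : Polynomial.C c * (Polynomial.X ^ j * q) =
      (Polynomial.X ^ (2 * j) - Polynomial.C 1) * (Polynomial.X ^ N * b) := by
    apply Polynomial.toLaurent_injective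
    simp only [map_mul, map_sub, Polynomial.toLaurent_X_pow, Polynomial.toLaurent_C, map_one]
    have hN : (T (N : ℤ) * T (-(N : ℤ)) : CoordRing) = 1 := by
      rw [← T_add, add_neg_cancel, T_zero]
    have hjj : (T (j : ℤ) * T (-(j : ℤ)) : CoordRing) = 1 := by
      rw [← T_add, add_neg_cancel, T_zero]
    have h2 : (T ((2 * j : ℕ) : ℤ) : CoordRing) = T (j : ℤ) * T (j : ℤ) := by
      rw [← T_add]
      congr 1
      push_cast
      ring
    rw [h2]
    linear_combination (T (j : ℤ) * T (N : ℤ)) * h -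
      (C c * T (j : ℤ) * q.toLaurent) * hN -
      (T (N : ℤ) * b.toLaurent) * hjj
  have hb : b = 0 := by
    by_contra hb
    have hd := congrArg Polynomial.degree key
    have hq0 : q ≠ 0 := by
      rintro rfl
      have hX : (Polynomial.X ^ (2 * j) - Polynomial.C 1 : Polynomial (Polynomial ℂ)) ≠ 0 :=
        Polynomial.X_pow_sub_C_ne_zero (by omega) 1
      rw [mul_zero, mul_zero] at key
      exact mul_ne_zero hX (mul_ne_zero (pow_ne_zero _ Polynomial.X_ne_zero) hb) key.symm
    rw [Polynomial.degree_mul, Polynomial.degree_mul, Polynomial.degree_mul, Polynomial.degree_mul,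
      Polynomial.degree_C hc, Polynomial.degree_X_pow, Polynomial.degree_X_pow,
      Polynomial.degree_X_pow_sub_C (by omega), Polynomial.degree_eq_natDegree hb,
      Polynomial.degree_eq_natDegree hq0] at hd
    rw [Polynomial.degree_eq_natDegree hq0] at hq
    norm_cast at hd hq
    omega
  subst hb
  simp only [mul_zero, mul_eq_zero, Polynomial.C_eq_zero, hc, pow_eq_zero_iff',
    Polynomial.X_ne_zero, false_and, false_or] at key
  simp [key]

/-- Lemma 6.7: if all `z`-exponents of `p` are `< j` and `2i·p = (z^j − z^{−j})·b` with
`b ∈ ℂ[z, u]`, then `b = 0` and `p = 0`; consequently if `p ≠ 0` the bundle with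
transition matrix `(z^j, p; 0, z^{−j})` has no traceless automorphism `(i, b; 0, −i)`. -/
theorem no_traceless_automorphisms (j : ℕ) (hj : 1 ≤ j) (p : CoordRing)
    (hp : HasZExponentsLT p j) :
    (∀ b : Polynomial (Polynomial ℂ),
        LaurentPolynomial.C (Polynomial.C (2 * Complex.I)) * p =
            (LaurentPolynomial.T (j : ℤ) - LaurentPolynomial.T (-(j : ℤ))) * b.toLaurent →
          b = 0 ∧ p = 0) ∧
      (p ≠ 0 → ∀ b : Polynomial (Polynomial ℂ),
        ¬ (!![iConst, b.toLaurent; 0, -iConst] * transitionMatrix j p =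
            transitionMatrix j p * !![iConst, b.toLaurent; 0, -iConst])) := by
  refine ⟨fun b h => eq_zero_of_C_mul_eq hj hp b h, fun hp0 b h => hp0 ?_⟩
  refine (eq_zero_of_C_mul_eq hj hp b ?_).2
  have h01 := congrFun (congrFun h 0) 1
  simp only [transitionMatrix, Matrix.mul_apply, Fin.sum_univ_two, Matrix.of_apply,
    Matrix.cons_val', Matrix.cons_val_zero, Matrix.cons_val_one, Matrix.cons_val_fin_one] at h01
  have hC : (LaurentPolynomial.C (Polynomial.C (2 * Complex.I)) : CoordRing) = 2 * iConst := by
    simp [iConst, two_mul]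
  rw [hC]
  linear_combination h01
end
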